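/- An ℕ-indexed family u = (U n)_{n∈ℕ} of subsets of a set X is a τ*-cover of X if and only if μ_u(X) can be enlarged to a simple P-filter, i.e. there exists a simple P-filter ℱ on ℕ with μ_u(X) ⊆ ℱ. -/

import Mathlib

open Set Cardinal

/-- `A ⊆* B` : almost inclusion, i.e. `A \ B` is finite. -/
def AlmostSub (A B : Set ℕ) : Prop := (A \ B).Finite

/-- The Marczewski map: `mu u x = {n | x ∈ u n}`. -/
def mu {X : Type*} (u : ℕ → Set X) (x : X) : Set ℕ := {n | x ∈ u n}

/-- `u` is a γ-cover: every `mu u x` is cofinite. -/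
def IsGammaCover {X : Type*} (u : ℕ → Set X) : Prop :=
  ∀ x : X, (mu u x)ᶜ.Finite

/-- `u` is an ω-cover: the family `mu u '' X` is centered. -/
def IsOmegaCover {X : Type*} (u : ℕ → Set X) : Prop :=
  ∀ K : Finset X, (⋂ x ∈ K, mu u x).Infinite

/-- `u` is a τ-cover. -/
def IsTauCover {X : Type*} (u : ℕ → Set X) : Prop :=
  (∀ x : X, (mu u x).Infinite) ∧
  ∀ x₁ x₂ : X, AlmostSub (mu u x₁) (mu u x₂) ∨ AlmostSub (mu u x₂) (mu u x₁)

/-- A family of sets of naturals is linearly preordered by `⊆*`. -/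
def LinearAlmost (J : Set (Set ℕ)) : Prop :=
  ∀ A ∈ J, ∀ B ∈ J, AlmostSub A B ∨ AlmostSub B A

/-- `u` is a τ*-cover: some family `J` of infinite subsets of `ℕ`, linearly
preordered by `⊆*`, refines `mu u '' X`. -/
def IsTauAstCover {X : Type*} (u : ℕ → Set X) : Prop :=
  ∃ J : Set (Set ℕ), (∀ A ∈ J, A.Infinite) ∧ LinearAlmost J ∧
    ∀ x : X, ∃ A ∈ J, A ⊆ mu u x

/-- `u` is a τ⋆-cover: some family `J ⊆ mu u '' X` of infinite subsets of `ℕ`,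
linearly preordered by `⊆*`, refines `mu u '' X`. -/
def IsTauStarCover {X : Type*} (u : ℕ → Set X) : Prop :=
  ∃ J : Set (Set ℕ), J ⊆ Set.range (mu u) ∧ (∀ A ∈ J, A.Infinite) ∧ LinearAlmost J ∧
    ∀ x : X, ∃ A ∈ J, A ⊆ mu u x

/-- An open cover of the whole space. -/
def IsOpenCover {X : Type*} [TopologicalSpace X] (u : Set (Set X)) : Prop :=
  (∀ U ∈ u, IsOpen U) ∧ ⋃₀ u = Set.univ

/-- The selection principle `Ufin(O, P)` : for every sequence of open covers `u n`
there are finite `v n ⊆ u n` such that the sequence `n ↦ ⋃₀ v n` satisfies `P`. -/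
def Ufin (X : Type*) [TopologicalSpace X] (P : (ℕ → Set X) → Prop) : Prop :=
  ∀ u : ℕ → Set (Set X), (∀ n, IsOpenCover (u n)) →
    ∃ v : ℕ → Set (Set X), (∀ n, (v n).Finite ∧ v n ⊆ u n) ∧ P (fun n => ⋃₀ v n)

/-- The Menger property `Ufin(O,O)`. -/
def UfinO (X : Type*) [TopologicalSpace X] : Prop :=
  Ufin X (fun w => ∀ x : X, ∃ n, x ∈ w n)

/-- The Hurewicz property `Ufin(O,Γ)`. -/
def UfinGamma (X : Type*) [TopologicalSpace X] : Prop := Ufin X IsGammaCover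

/-- `Ufin(O,Ω)`. -/
def UfinOmega (X : Type*) [TopologicalSpace X] : Prop := Ufin X IsOmegaCover

/-- `Ufin(O,T)`. -/
def UfinTau (X : Type*) [TopologicalSpace X] : Prop := Ufin X IsTauCover

/-- `Ufin(O,T*)`. -/
def UfinTauAst (X : Type*) [TopologicalSpace X] : Prop := Ufin X IsTauAstCover

/-- `Ufin(O,T⋆)`. -/
def UfinTauStar (X : Type*) [TopologicalSpace X] : Prop := Ufin X IsTauStarCover

/-- The upward `⊆*`-closure of a family of subsets of `ℕ`. -/
def upCl (A : Set (Set ℕ)) : Set (Set ℕ) := {B | ∃ a ∈ A, AlmostSub a B}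

/-- A semifilter on `ℕ`. -/
def IsSemifilter (F : Set (Set ℕ)) : Prop :=
  (∀ A ∈ F, A.Nonempty) ∧ ∀ A ∈ F, ∀ B : Set ℕ, AlmostSub A B → B ∈ F

/-- A filter on `ℕ` (in the semifilter sense): a semifilter closed under finite
intersections. -/
def IsFilterFam (F : Set (Set ℕ)) : Prop :=
  IsSemifilter F ∧ ∀ A ∈ F, ∀ B ∈ F, A ∩ B ∈ F

/-- A simple P-filter: a filter consisting of infinite sets with a base linearly
preordered by `⊆*`. -/
def IsSimplePFilter (F : Set (Set ℕ)) : Prop :=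
  IsFilterFam F ∧ (∀ A ∈ F, A.Infinite) ∧
  ∃ B : Set (Set ℕ), B ⊆ F ∧ F = upCl B ∧ LinearAlmost B

/-- A family of subsets of `ℕ` is meager if the corresponding set of
characteristic functions is meager in the Cantor space `ℕ → Bool`. -/
def MeagerFam (F : Set (Set ℕ)) : Prop :=
  IsMeagre {f : ℕ → Bool | {n | f n = true} ∈ F}

/-- A family of subsets of `ℕ` is comeager if the corresponding set of
characteristic functions is comeager in the Cantor space `ℕ → Bool`. -/
def ComeagerFam (F : Set (Set ℕ)) : Prop :=
  {f : ℕ → Bool | {n | f n = true} ∈ F} ∈ residual (ℕ → Bool)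

/-- `x ≤* y` : eventual dominance. -/
def evLE (x y : ℕ → ℕ) : Prop := {n | y n < x n}.Finite

/-- The unbounding number `𝔟`. -/
noncomputable def cardB : Cardinal :=
  sInf {c | ∃ S : Set (ℕ → ℕ), c = #S ∧ ¬ ∃ y : ℕ → ℕ, ∀ x ∈ S, evLE x y}

/-- The dominating number `𝔡`. -/
noncomputable def cardD : Cardinal :=
  sInf {c | ∃ S : Set (ℕ → ℕ), c = #S ∧ ∀ x : ℕ → ℕ, ∃ y ∈ S, evLE x y}

/-- The ultrafilter number `𝔲`. -/
noncomputable def cardU : Cardinal :=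
  sInf {c | ∃ (U : Ultrafilter ℕ) (B : Set (Set ℕ)), c = #B ∧
    (∀ A ∈ U, A.Infinite) ∧ (∀ b ∈ B, b ∈ U) ∧ ∀ A ∈ U, ∃ b ∈ B, b ⊆ A}

/-- A groupwise dense family of infinite subsets of `ℕ`. -/
def IsGroupwiseDense (G : Set (Set ℕ)) : Prop :=
  (∀ A ∈ G, A.Infinite) ∧
  (∀ A ∈ G, ∀ B : Set ℕ, B.Infinite → B ⊆ A → B ∈ G) ∧
  ∀ k : ℕ → ℕ, StrictMono k →
    ∃ S : Set ℕ, S.Infinite ∧ (⋃ n ∈ S, Set.Ico (k n) (k (n + 1))) ∈ G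

/-- The groupwise density number `𝔤`. -/
noncomputable def cardG : Cardinal :=
  sInf {c | ∃ 𝒢 : Set (Set (Set ℕ)), c = #𝒢 ∧ (∀ G ∈ 𝒢, IsGroupwiseDense G) ∧ ⋂₀ 𝒢 = ∅}

/-- A tower of length `lam`: a `⊆*`-decreasing transfinite sequence of infinite
subsets of `ℕ` indexed by the ordinals below `lam`. -/
def IsTower (lam : Ordinal) (T : Ordinal → Set ℕ) : Prop :=
  (∀ α < lam, (T α).Infinite) ∧
  ∀ β α : Ordinal, β ≤ α → α < lam → AlmostSub (T α) (T β)

/-- `Depth⁺([ω]^{ℵ₀})`: the least cardinal `κ` such that there is no tower of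
length `κ`. -/
noncomputable def depthPlus : Cardinal :=
  sInf {c : Cardinal | ¬ ∃ T : Ordinal → Set ℕ, IsTower c.ord T}

/-- The tower number `𝔱`: the least length of a tower with no infinite
pseudo-intersection. -/
noncomputable def cardT : Cardinal :=
  sInf {c : Cardinal | ∃ T : Ordinal → Set ℕ, IsTower c.ord T ∧
    ¬ ∃ A : Set ℕ, A.Infinite ∧ ∀ α < c.ord, AlmostSub A (T α)}

/-- The trace of a family on the intervals determined by `k`. -/
def intervalTrace (k : ℕ → ℕ) (F : Set (Set ℕ)) : Set (Set ℕ) :=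
  {S | ∃ A ∈ F, S = {n | (A ∩ Set.Ico (k n) (k (n + 1))).Nonempty}}

/-- The Filter Dichotomy principle. -/
def FilterDichotomy : Prop :=
  ∀ F U : Set (Set ℕ), IsFilterFam F → IsFilterFam U →
    ¬ MeagerFam F → ¬ ComeagerFam F → ¬ MeagerFam U → ¬ ComeagerFam U →
    ∃ k : ℕ → ℕ, StrictMono k ∧ intervalTrace k F = intervalTrace k U

/-- `B` is `u`-bounded: `B` is contained in the union of a finite subfamily of `u`. -/
def BoundedBy {X : Type*} (u : Set (Set X)) (B : Set X) : Prop :=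
  ∃ v : Set (Set X), v ⊆ u ∧ v.Finite ∧ B ⊆ ⋃₀ v

/-- The weak excluded middle property of a subset of the Baire space. -/
def WeakExcludedMiddle (Z : Set (ℕ → ℕ)) : Prop :=
  ∃ x : ℕ → ℕ, ∃ F : Set (Set ℕ), IsSimplePFilter F ∧ ∀ z ∈ Z, {n | z n ≤ x n} ∈ F

theorem AlmostSub.refl (A : Set ℕ) : AlmostSub A A := by simp [AlmostSub]

theorem AlmostSub.of_subset {A B : Set ℕ} (h : A ⊆ B) : AlmostSub A B := by
  simp [AlmostSub, Set.sdiff_eq_empty.2 h]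

theorem AlmostSub.trans {A B C : Set ℕ} (h₁ : AlmostSub A B) (h₂ : AlmostSub B C) :
    AlmostSub A C :=
  (h₁.union h₂).subset fun n hn =>
    (em (n ∈ B)).elim (fun h => Or.inr ⟨h, hn.2⟩) fun h => Or.inl ⟨hn.1, h⟩

theorem AlmostSub.inter {A B C : Set ℕ} (h₁ : AlmostSub A B) (h₂ : AlmostSub A C) :
    AlmostSub A (B ∩ C) := by
  rw [AlmostSub, Set.sdiff_inter]
  exact h₁.union h₂

theorem AlmostSub.infinite {A B : Set ℕ} (h : AlmostSub A B) (hA : A.Infinite) : B.Infinite :=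
  fun hB => hA ((hB.union h).subset fun n hn =>
    (em (n ∈ B)).elim Or.inl fun hnB => Or.inr ⟨hn, hnB⟩)

/-- The upward closure of a linearly preordered family of infinite sets is a simple P-filter. -/
theorem isSimplePFilter_upCl {J : Set (Set ℕ)} (hinf : ∀ A ∈ J, A.Infinite)
    (hlin : LinearAlmost J) : IsSimplePFilter (upCl J) := by
  have hup : ∀ A ∈ upCl J, A.Infinite := fun A ⟨a, ha, haA⟩ => haA.infinite (hinf a ha)
  refine ⟨⟨⟨fun A hA => (hup A hA).nonempty, ?_⟩, ?_⟩, hup, J, ?_, rfl, hlin⟩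
  · rintro A ⟨a, ha, haA⟩ B hAB
    exact ⟨a, ha, haA.trans hAB⟩
  · rintro A ⟨a, ha, haA⟩ B ⟨b, hb, hbB⟩
    rcases hlin a ha b hb with hab | hba
    · exact ⟨a, ha, haA.inter (hab.trans hbB)⟩
    · exact ⟨b, hb, (hba.trans haA).inter hbB⟩
  · exact fun A hA => ⟨A, hA, AlmostSub.refl A⟩

/-- Closing a linearly preordered family under finite modifications keeps it linearly
preordered. -/
theorem LinearAlmost.finite_modifications {B : Set (Set ℕ)} (hB : LinearAlmost B) :
    LinearAlmost {A | ∃ b ∈ B, AlmostSub A b ∧ AlmostSub b A} := by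
  rintro A ⟨a, ha, hAa, haA⟩ C ⟨c, hc, hCc, hcC⟩
  exact (hB a ha c hc).imp (fun h => hAa.trans (h.trans hcC)) fun h => hCc.trans (h.trans haA)

/-- A family `u` is a τ*-cover of `X` iff `mu u '' X` can be enlarged to a
simple P-filter. -/
theorem stmt_9 {X : Type*} (u : ℕ → Set X) :
    IsTauAstCover u ↔ ∃ F : Set (Set ℕ), IsSimplePFilter F ∧ Set.range (mu u) ⊆ F := by
  constructor
  · rintro ⟨J, hinf, hlin, href⟩
    refine ⟨upCl J, isSimplePFilter_upCl hinf hlin, ?_⟩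
    rintro _ ⟨x, rfl⟩
    obtain ⟨A, hA, hAx⟩ := href x
    exact ⟨A, hA, AlmostSub.of_subset hAx⟩
  · rintro ⟨F, ⟨-, hinf, B, hBF, rfl, hlin⟩, hF⟩
    refine ⟨_, ?_, hlin.finite_modifications, fun x => ?_⟩
    · rintro A ⟨b, hb, -, hbA⟩
      exact hbA.infinite (hinf b (hBF hb))
    · obtain ⟨b, hb, hbx⟩ := hF ⟨x, rfl⟩
      exact ⟨b ∩ mu u x, ⟨b, hb, AlmostSub.of_subset Set.inter_subset_left,
        (AlmostSub.refl b).inter hbx⟩, Set.inter_subset_right⟩
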